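/- arXiv:2303.17053 — 2 statements merged into one kernel-verified Lean document; each statement's English description precedes it below -/
import Mathlib

section
/- Let X be a compact Hausdorff, locally connected topological space, let L ⊆ X be closed, let K be a connected component of L, and let V be an open set with K ⊆ V. Then there exists a connected open set U with K ⊆ U ⊆ V whose topological boundary is disjoint from L, i.e. (closure(U) \ U) ∩ L = ∅. -/
/-- In a compact Hausdorff locally connected space, given a closed set `L`, a connected
component `K` of `L`, and an open set `V ⊇ K`, there is a connected open set `U` with
`K ⊆ U ⊆ V` whose boundary misses `L`. -/
theorem exists_connected_open_nbhd_of_component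
    {X : Type*} [TopologicalSpace X] [CompactSpace X] [T2Space X] [LocallyConnectedSpace X]
    (L : Set X) (hL : IsClosed L)
    (K : Set X) (hK : ∃ x ∈ L, K = connectedComponentIn L x)
    (V : Set X) (hV : IsOpen V) (hKV : K ⊆ V) :
    ∃ U : Set X, IsOpen U ∧ IsConnected U ∧ K ⊆ U ∧ U ⊆ V ∧
      (closure U \ U) ∩ L = ∅ := by
  obtain ⟨x, hx, rfl⟩ := hK
  haveI : CompactSpace L := isCompact_iff_compactSpace.mp hL.isCompact
  have hc : connectedComponent (⟨x, hx⟩ : L) ⊆ Subtype.val ⁻¹' V := by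
    intro y hy
    apply hKV
    rw [connectedComponentIn_eq_image hx]
    exact ⟨y, hy, rfl⟩
  obtain ⟨A, hA, hxA, hAV⟩ : ∃ A : Set L, IsClopen A ∧ (⟨x, hx⟩ : L) ∈ A ∧
      A ⊆ Subtype.val ⁻¹' V := by
    rw [connectedComponent_eq_iInter_isClopen] at hc
    haveI : Nonempty { s : Set L // IsClopen s ∧ (⟨x, hx⟩ : L) ∈ s } :=
      ⟨⟨Set.univ, isClopen_univ, trivial⟩⟩
    obtain ⟨i, hi⟩ := exists_subset_nhds_of_isCompact'
      (V := fun s : { s : Set L // IsClopen s ∧ (⟨x, hx⟩ : L) ∈ s } => (s : Set L))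
      (fun a b => ⟨⟨a.1 ∩ b.1, a.2.1.inter b.2.1, a.2.2, b.2.2⟩,
        Set.inter_subset_left, Set.inter_subset_right⟩)
      (fun i => i.2.1.isClosed.isCompact) (fun i => i.2.1.isClosed)
      (U := Subtype.val ⁻¹' V)
      (fun y hy => (hV.preimage continuous_subtype_val).mem_nhds (hc hy))
    exact ⟨i.1, i.2.1, i.2.2, hi⟩
  have hKA : connectedComponentIn L x ⊆ Subtype.val '' A := by
    rw [connectedComponentIn_eq_image hx]
    exact Set.image_mono (hA.connectedComponent_subset hxA)
  have h1 : IsClosed (Subtype.val '' A : Set X) :=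
    hL.isClosedEmbedding_subtypeVal.isClosedMap _ hA.isClosed
  have h2 : IsClosed (Subtype.val '' Aᶜ : Set X) :=
    hL.isClosedEmbedding_subtypeVal.isClosedMap _ hA.compl.isClosed
  obtain ⟨W, hW, hAW, hWc⟩ := normal_exists_closure_subset h1 (hV.inter h2.isOpen_compl) (by
    rintro _ ⟨a, ha, rfl⟩
    refine ⟨hAV ha, ?_⟩
    rintro ⟨b, hb, hab⟩
    exact hb (Subtype.ext hab ▸ ha))
  have hxW : x ∈ W := hAW ⟨_, hxA, rfl⟩
  refine ⟨connectedComponentIn W x, hW.connectedComponentIn,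
    isConnected_connectedComponentIn_iff.mpr hxW,
    isPreconnected_connectedComponentIn.subset_connectedComponentIn
      (mem_connectedComponentIn hx) (hKA.trans hAW),
    fun y hy => (hWc (subset_closure (connectedComponentIn_subset _ _ hy))).1, ?_⟩
  rw [Set.eq_empty_iff_forall_notMem]
  rintro y ⟨⟨hy, hyU⟩, hyL⟩
  have hyA : (⟨y, hyL⟩ : L) ∈ A := by
    by_contra h
    exact (hWc (closure_mono (connectedComponentIn_subset _ _) hy)).2 ⟨⟨y, hyL⟩, h, rfl⟩
  have hyW : y ∈ W := hAW ⟨_, hyA, rfl⟩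
  obtain ⟨z, hz1, hz2⟩ := mem_closure_iff.mp hy _ (hW.connectedComponentIn (x := y))
    (mem_connectedComponentIn hyW)
  apply hyU
  rw [connectedComponentIn_eq hz2, ← connectedComponentIn_eq hz1]
  exact mem_connectedComponentIn hyW
end

section
/- Let n ≥ 2, let σ denote the spherical (surface) measure on the unit sphere S^{n-1} ⊆ ℝⁿ, let L ⊆ S^{n-1} be closed, and let M > 0. Suppose that every connected component of L has σ-measure strictly less than M. Then there exist finitely many connected open subsets U₁, …, U_p of S^{n-1} that cover S^{n-1} and such that for each i the boundary of U_i (relative to S^{n-1}) is disjoint from L and σ(U_i) < M. -/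
open Metric MeasureTheory

/-- A component of a well-chosen neighbourhood of a compact set `K` with `O ∩ L ⊆ K ⊆ O`. -/
theorem exists_conn_nhd {X : Type*} [TopologicalSpace X] [CompactSpace X] [T2Space X]
    [LocallyConnectedSpace X] (L K O : Set X) (hK : IsCompact K) (hO : IsOpen O)
    (hKO : K ⊆ O) (hOL : O ∩ L ⊆ K) (x : X) (hx : x ∈ K) :
    ∃ U : Set X, x ∈ U ∧ IsOpen U ∧ IsConnected U ∧ (closure U \ U) ∩ L = ∅ ∧ U ⊆ O := by
  obtain ⟨V, hV, hKV, hVO, -⟩ := exists_open_between_and_isCompact_closure hK hO hKO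
  have hxV : x ∈ V := hKV hx
  refine ⟨connectedComponentIn V x, mem_connectedComponentIn hxV, hV.connectedComponentIn,
    isConnected_connectedComponentIn_iff.2 hxV, ?_,
    (connectedComponentIn_subset V x).trans (subset_closure.trans hVO)⟩
  rw [Set.eq_empty_iff_forall_notMem]
  rintro y ⟨⟨hy1, hy2⟩, hyL⟩
  have hyV : y ∈ V :=
    hKV (hOL ⟨hVO (closure_mono (connectedComponentIn_subset V x) hy1), hyL⟩)
  obtain ⟨z, hz1, hz2⟩ := mem_closure_iff.1 hy1 _ (hV.connectedComponentIn (x := y))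
    (mem_connectedComponentIn hyV)
  have h1 := connectedComponentIn_eq hz1
  have h2 := connectedComponentIn_eq hz2
  exact hy2 (h2.trans h1.symm ▸ mem_connectedComponentIn hyV)

/-- A neighbourhood `W` of a component of `L` contains a relatively clopen piece of `L`. -/
theorem exists_clopen_piece {X : Type*} [TopologicalSpace X] [CompactSpace X] [T2Space X]
    (L W : Set X) (hL : IsClosed L) (hW : IsOpen W) (x : X) (hx : x ∈ L)
    (hC : connectedComponentIn L x ⊆ W) :
    ∃ K O : Set X, IsCompact K ∧ IsOpen O ∧ K ⊆ O ∧ O ∩ L ⊆ K ∧ x ∈ K ∧ O ⊆ W := by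
  have : CompactSpace L := isCompact_iff_compactSpace.1 hL.isCompact
  rw [connectedComponentIn_eq_image hx, Set.image_subset_iff,
    connectedComponent_eq_iInter_isClopen] at hC
  have hd : Directed (· ⊇ ·) (fun s : { s : Set L // IsClopen s ∧ (⟨x, hx⟩ : L) ∈ s } => s.1) := by
    intro a b
    exact ⟨⟨a.1 ∩ b.1, a.2.1.inter b.2.1, a.2.2, b.2.2⟩, Set.inter_subset_left,
      Set.inter_subset_right⟩
  have : Nonempty { s : Set L // IsClopen s ∧ (⟨x, hx⟩ : L) ∈ s } :=
    ⟨⟨Set.univ, isClopen_univ, trivial⟩⟩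
  obtain ⟨⟨s, hs, hxs⟩, hsW⟩ := exists_subset_nhds_of_compactSpace
    hd (fun s => s.2.1.1)
    (U := Subtype.val ⁻¹' W) (fun y hy => (hW.preimage continuous_subtype_val).mem_nhds (hC hy))
  have hK : IsCompact (Subtype.val '' s : Set X) :=
    hs.1.isCompact.image continuous_subtype_val
  have hK' : IsCompact (Subtype.val '' sᶜ : Set X) :=
    hs.compl.1.isCompact.image continuous_subtype_val
  refine ⟨Subtype.val '' s, W ∩ (Subtype.val '' sᶜ)ᶜ, hK, hW.inter hK'.isClosed.isOpen_compl,
    ?_, ?_, ⟨_, hxs, rfl⟩, Set.inter_subset_left⟩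
  · rintro _ ⟨y, hy, rfl⟩
    refine ⟨hsW hy, ?_⟩
    rintro ⟨z, hz, hzy⟩
    exact hz (Subtype.ext hzy ▸ hy)
  · rintro y ⟨⟨-, h2⟩, hy⟩
    by_contra h
    exact h2 ⟨⟨y, hy⟩, fun h' => h ⟨_, h', rfl⟩, rfl⟩

open scoped Pointwise in
/-- Points have zero surface measure. -/
theorem toSphere_singleton (n : ℕ) (hn : 2 ≤ n) (x : sphere (0 : EuclideanSpace ℝ (Fin n)) 1) :
    (volume : Measure (EuclideanSpace ℝ (Fin n))).toSphere {x} = 0 := by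
  rw [Measure.toSphere_apply' _ (measurableSet_singleton x)]
  have h : volume (Set.Ioo (0:ℝ) 1 • (Subtype.val '' {x} : Set (EuclideanSpace ℝ (Fin n)))) = 0 := by
    refine measure_mono_null ?_
      (Measure.addHaar_submodule volume (Submodule.span ℝ {(x : EuclideanSpace ℝ (Fin n))}) ?_)
    · rintro _ ⟨r, -, _, ⟨y, rfl, rfl⟩, rfl⟩
      exact Submodule.smul_mem _ _ (Submodule.mem_span_singleton_self _)
    · intro h
      have h1 := finrank_span_singleton (K := ℝ) (ne_zero_of_mem_unit_sphere x)
      rw [h, finrank_top, finrank_euclideanSpace_fin] at h1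
      omega
  rw [h, mul_zero]

/-- Let `σ` be the spherical surface measure on `S^{n-1} ⊆ ℝⁿ` (`n ≥ 2`), `L ⊆ S^{n-1}`
closed, and `M > 0`. If every connected component of `L` has `σ`-measure `< M`, then
`S^{n-1}` can be covered by finitely many connected open sets, each of `σ`-measure `< M`
and whose boundary misses `L`. -/
theorem sphere_cover_by_connected_open_sets
    (n : ℕ) (hn : 2 ≤ n)
    (L : Set (sphere (0 : EuclideanSpace ℝ (Fin n)) 1)) (hL : IsClosed L)
    (M : ℝ) (hM : 0 < M)
    (hcomp : ∀ x ∈ L,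
      (volume : Measure (EuclideanSpace ℝ (Fin n))).toSphere (connectedComponentIn L x)
        < ENNReal.ofReal M) :
    ∃ (p : ℕ) (U : Fin p → Set (sphere (0 : EuclideanSpace ℝ (Fin n)) 1)),
      (⋃ i, U i) = Set.univ ∧
      ∀ i, IsOpen (U i) ∧ IsConnected (U i) ∧ (closure (U i) \ U i) ∩ L = ∅ ∧
        (volume : Measure (EuclideanSpace ℝ (Fin n))).toSphere (U i) < ENNReal.ofReal M := by
  have : Fact (Module.finrank ℝ (EuclideanSpace ℝ (Fin n)) = (n - 1) + 1) :=
    ⟨by rw [finrank_euclideanSpace_fin]; omega⟩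
  have : LocallyConnectedSpace (sphere (0 : EuclideanSpace ℝ (Fin n)) 1) :=
    ChartedSpace.locallyConnectedSpace (EuclideanSpace ℝ (Fin (n - 1))) _
  have key : ∀ x : sphere (0 : EuclideanSpace ℝ (Fin n)) 1, ∃ U : Set _, x ∈ U ∧ IsOpen U ∧
      IsConnected U ∧ (closure U \ U) ∩ L = ∅ ∧
      (volume : Measure (EuclideanSpace ℝ (Fin n))).toSphere U < ENNReal.ofReal M := by
    intro x
    by_cases hx : x ∈ L
    · obtain ⟨W, hCW, hW, hWM⟩ := Set.exists_isOpen_lt_of_lt _ _ (hcomp x hx)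
      obtain ⟨K, O, hK, hO, hKO, hOL, hxK, hOW⟩ := exists_clopen_piece L W hL hW x hx hCW
      obtain ⟨U, h1, h2, h3, h4, h5⟩ := exists_conn_nhd L K O hK hO hKO hOL x hxK
      exact ⟨U, h1, h2, h3, h4, (measure_mono (h5.trans hOW)).trans_lt hWM⟩
    · obtain ⟨W, hCW, hW, hWM⟩ := Set.exists_isOpen_lt_of_lt {x} (ENNReal.ofReal M)
        (by rw [toSphere_singleton n hn x]; exact ENNReal.ofReal_pos.2 hM)
      obtain ⟨U, h1, h2, h3, h4, h5⟩ := exists_conn_nhd L {x} (W ∩ Lᶜ) isCompact_singleton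
        (hW.inter hL.isOpen_compl) (by rintro _ rfl; exact ⟨hCW rfl, hx⟩)
        (fun y hy => absurd hy.2 hy.1.2) x rfl
      exact ⟨U, h1, h2, h3, h4,
        (measure_mono (h5.trans Set.inter_subset_left)).trans_lt hWM⟩
  choose U hxU hU using key
  obtain ⟨t, ht⟩ := isCompact_univ.elim_finite_subcover U (fun x => (hU x).1)
    (fun x _ => Set.mem_iUnion.2 ⟨x, hxU x⟩)
  refine ⟨t.card, fun i => U (t.equivFin.symm i), ?_, fun i => hU _⟩
  refine Set.eq_univ_of_forall fun y => ?_
  obtain ⟨x, hx, hy⟩ := Set.mem_iUnion₂.1 (ht (Set.mem_univ y))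
  exact Set.mem_iUnion.2 ⟨t.equivFin ⟨x, hx⟩, by simpa using hy⟩
end
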